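/- Define f₁ : ℝ → ℝ by f₁(x) = x·sin(ln x) + x·cos(ln x) + 5x for x > 0 and f₁(x) = 6x for x ≤ 0, and f₂ : ℝ → ℝ by f₂(x) = 3|x|. Then f₁ and f₂ are not invex with respect to the same function η: there is no function η : ℝ × ℝ → ℝ such that for all x, u ∈ ℝ one has f₁(x) − f₁(u) ≥ ξ₁·η(x, u) for every ξ₁ ∈ ∂f₁(u) and f₂(x) − f₂(u) ≥ ξ₂·η(x, u) for every ξ₂ ∈ ∂f₂(u). (In fact, already for x = −1/3 and u = 0 there is no real number η₀ satisfying both f₁(−1/3) − f₁(0) ≥ ξ₁·η₀ for all ξ₁ ∈ ∂f₁(0) and f₂(−1/3) − f₂(0) ≥ ξ₂·η₀ for all ξ₂ ∈ ∂f₂(0).) -/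

import Mathlib

open Filter Set

/-- Clarke's generalized directional derivative of `f : ℝ → ℝ` at `u` in direction `d`. -/
noncomputable def clarkeDeriv1 (f : ℝ → ℝ) (u d : ℝ) : ℝ :=
  Filter.limsup (fun p : ℝ × ℝ => (f (p.1 + p.2 * d) - f p.1) / p.2)
    ((nhds u) ×ˢ (nhdsWithin 0 (Set.Ioi (0:ℝ))))

/-- Clarke's subdifferential of `f : ℝ → ℝ` at `u`. -/
noncomputable def clarkeSubdiff1 (f : ℝ → ℝ) (u : ℝ) : Set ℝ :=
  {ξ | ∀ d, ξ * d ≤ clarkeDeriv1 f u d}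

/-- The example function `f₁`. -/
noncomputable def f₁ : ℝ → ℝ := fun x =>
  if 0 < x then x * Real.sin (Real.log x) + x * Real.cos (Real.log x) + 5 * x else 6 * x

/-- The example function `f₂`. -/
noncomputable def f₂ : ℝ → ℝ := fun x => 3 * |x|

/-- Difference quotients along a sequence of base points and step sizes bound Clarke's derivative
of a Lipschitz function from below. -/
theorem le_clarkeDeriv1_of_tendsto {f : ℝ → ℝ} {K : ℝ} (hf : ∀ x y, |f x - f y| ≤ K * |x - y|)
    {u d c : ℝ} {y t : ℕ → ℝ} (hy : Tendsto y atTop (nhds u)) (ht : Tendsto t atTop (nhds 0))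
    (ht0 : ∀ n, 0 < t n) (hc : ∀ n, c ≤ (f (y n + t n * d) - f (y n)) / t n) :
    c ≤ clarkeDeriv1 f u d := by
  have hlim : Tendsto (fun n => (y n, t n)) atTop
      ((nhds u) ×ˢ (nhdsWithin 0 (Set.Ioi (0:ℝ)))) :=
    hy.prodMk (tendsto_nhdsWithin_iff.2 ⟨ht, Eventually.of_forall ht0⟩)
  refine le_limsup_of_frequently_le (hlim.frequently (Frequently.of_forall hc)) ?_
  refine isBoundedUnder_of_eventually_le (a := K * |d|) ?_
  have hpos : ∀ᶠ p : ℝ × ℝ in (nhds u) ×ˢ (nhdsWithin 0 (Set.Ioi (0:ℝ))), 0 < p.2 :=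
    tendsto_snd.eventually self_mem_nhdsWithin
  filter_upwards [hpos] with p hp
  rw [div_le_iff₀ hp]
  have h := hf (p.1 + p.2 * d) p.1
  rw [add_sub_cancel_left, abs_mul, abs_of_pos hp] at h
  linarith [le_abs_self (f (p.1 + p.2 * d) - f p.1)]

theorem f₁_of_pos {x : ℝ} (hx : 0 < x) :
    f₁ x = x * Real.sin (Real.log x) + x * Real.cos (Real.log x) + 5 * x := if_pos hx

theorem f₁_of_nonpos {x : ℝ} (hx : x ≤ 0) : f₁ x = 6 * x := if_neg hx.not_gt

theorem hasDerivAt_f₁_of_pos {x : ℝ} (hx : 0 < x) :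
    HasDerivAt f₁ (2 * Real.cos (Real.log x) + 5) x := by
  have hl := Real.hasDerivAt_log hx.ne'
  have h := (((hasDerivAt_id x).mul hl.sin).add ((hasDerivAt_id x).mul hl.cos)).add
    ((hasDerivAt_id x).const_mul 5)
  refine (h.congr_of_eventuallyEq ?_).congr_deriv ?_
  · filter_upwards [lt_mem_nhds hx] with z hz
    simp [f₁_of_pos hz]
  · simp only [id]
    field_simp
    ring

theorem abs_f₁_sub_le_of_le {x y : ℝ} (hxy : x ≤ y) : |f₁ y - f₁ x| ≤ 7 * |y - x| := by
  rcases le_or_gt y 0 with hy | hy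
  · rw [f₁_of_nonpos hy, f₁_of_nonpos (hxy.trans hy), ← mul_sub, abs_mul, abs_of_pos (by norm_num)]
    linarith [abs_nonneg (y - x)]
  rcases le_or_gt x 0 with hx | hx
  · rw [f₁_of_nonpos hx, f₁_of_pos hy, abs_of_nonneg (sub_nonneg.2 hxy), abs_le]
    have := Real.sin_le_one (Real.log y)
    have := Real.cos_le_one (Real.log y)
    have := Real.neg_one_le_sin (Real.log y)
    have := Real.neg_one_le_cos (Real.log y)
    constructor <;> nlinarith
  · have h := (convex_Ioi (0:ℝ)).norm_image_sub_le_of_norm_hasDerivWithin_le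
      (f := f₁) (C := 7) (fun z hz => (hasDerivAt_f₁_of_pos hz).hasDerivWithinAt)
      (fun z _ => by
        rw [Real.norm_eq_abs, abs_le]
        constructor <;>
          linarith [Real.cos_le_one (Real.log z), Real.neg_one_le_cos (Real.log z)]) hx hy
    simpa only [Real.norm_eq_abs] using h

theorem abs_f₁_sub_le (x y : ℝ) : |f₁ x - f₁ y| ≤ 7 * |x - y| := by
  rcases le_total y x with h | h
  · exact abs_f₁_sub_le_of_le h
  · rw [abs_sub_comm, abs_sub_comm x]
    exact abs_f₁_sub_le_of_le h

theorem abs_f₂_sub_le (x y : ℝ) : |f₂ x - f₂ y| ≤ 3 * |x - y| := by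
  rw [f₂, f₂, ← mul_sub, abs_mul, abs_of_pos (by norm_num : (0:ℝ) < 3)]
  exact mul_le_mul_of_nonneg_left (abs_abs_sub_abs_le x y) (by norm_num)

theorem f₁_exp_pi_sub (n : ℕ) :
    f₁ (Real.exp (Real.pi - n * (2 * Real.pi))) = 4 * Real.exp (Real.pi - n * (2 * Real.pi)) := by
  rw [f₁_of_pos (Real.exp_pos _), Real.log_exp, Real.sin_sub_nat_mul_two_pi,
    Real.cos_sub_nat_mul_two_pi, Real.sin_pi, Real.cos_pi]
  ring

theorem tendsto_exp_pi_sub :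
    Tendsto (fun n : ℕ => Real.exp (Real.pi - n * (2 * Real.pi))) atTop (nhds 0) := by
  refine Real.tendsto_exp_atBot.comp (tendsto_const_nhds.add_atBot
    (f := fun _ : ℕ => Real.pi) (tendsto_neg_atTop_atBot.comp ?_))
  exact tendsto_natCast_atTop_atTop.atTop_mul_const Real.two_pi_pos

theorem four_mem_clarkeSubdiff1_f₁ : (4 : ℝ) ∈ clarkeSubdiff1 f₁ 0 := by
  intro d
  rcases le_or_gt 0 d with hd | hd
  · have ht := tendsto_one_div_add_atTop_nhds_zero_nat (𝕜 := ℝ)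
    have hy : Tendsto (fun n : ℕ => -(1 / ((n : ℝ) + 1) * d)) atTop (nhds 0) := by
      simpa using (ht.mul_const d).neg
    refine le_clarkeDeriv1_of_tendsto abs_f₁_sub_le hy ht
      (fun n => Nat.one_div_pos_of_nat) fun n => ?_
    have htn : 0 < 1 / ((n : ℝ) + 1) := Nat.one_div_pos_of_nat
    rw [le_div_iff₀ htn, neg_add_cancel, f₁_of_nonpos le_rfl,
      f₁_of_nonpos (neg_nonpos.2 (mul_nonneg htn.le hd))]
    nlinarith [mul_nonneg htn.le hd]
  · have ht : Tendsto (fun n : ℕ => Real.exp (Real.pi - n * (2 * Real.pi)) / -d) atTop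
        (nhds 0) := by
      simpa using tendsto_exp_pi_sub.div_const (-d)
    refine le_clarkeDeriv1_of_tendsto abs_f₁_sub_le tendsto_exp_pi_sub ht
      (fun n => div_pos (Real.exp_pos _) (neg_pos.2 hd)) fun n => ?_
    have hcancel (e : ℝ) : e + e / -d * d = 0 := by
      field_simp [hd.ne]
      ring
    rw [le_div_iff₀ (div_pos (Real.exp_pos _) (neg_pos.2 hd)), hcancel, f₁_exp_pi_sub,
      f₁_of_nonpos le_rfl]
    linarith [hcancel (Real.exp (Real.pi - n * (2 * Real.pi)))]

theorem neg_three_mem_clarkeSubdiff1_f₂ : (-3 : ℝ) ∈ clarkeSubdiff1 f₂ 0 := by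
  intro d
  refine le_clarkeDeriv1_of_tendsto abs_f₂_sub_le (tendsto_const_nhds (x := (0:ℝ)))
    (tendsto_one_div_add_atTop_nhds_zero_nat (𝕜 := ℝ))
    (fun n => Nat.one_div_pos_of_nat) fun n => ?_
  have htn : 0 < 1 / ((n : ℝ) + 1) := Nat.one_div_pos_of_nat
  rw [le_div_iff₀ htn, f₂, f₂, zero_add, abs_zero, abs_mul, abs_of_pos htn]
  nlinarith [mul_le_mul_of_nonneg_left (neg_abs_le d) htn.le,
    mul_le_mul_of_nonneg_left (neg_le_abs d) htn.le]

theorem stmt8 :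
    (¬ ∃ η : ℝ × ℝ → ℝ, ∀ x u : ℝ,
        (∀ ξ₁ ∈ clarkeSubdiff1 f₁ u, f₁ x - f₁ u ≥ ξ₁ * η (x, u)) ∧
        (∀ ξ₂ ∈ clarkeSubdiff1 f₂ u, f₂ x - f₂ u ≥ ξ₂ * η (x, u))) ∧
    (¬ ∃ η₀ : ℝ,
        (∀ ξ₁ ∈ clarkeSubdiff1 f₁ 0, f₁ (-1/3) - f₁ 0 ≥ ξ₁ * η₀) ∧
        (∀ ξ₂ ∈ clarkeSubdiff1 f₂ 0, f₂ (-1/3) - f₂ 0 ≥ ξ₂ * η₀)) := by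
  have key : ¬ ∃ η₀ : ℝ,
      (∀ ξ₁ ∈ clarkeSubdiff1 f₁ 0, f₁ (-1/3) - f₁ 0 ≥ ξ₁ * η₀) ∧
      (∀ ξ₂ ∈ clarkeSubdiff1 f₂ 0, f₂ (-1/3) - f₂ 0 ≥ ξ₂ * η₀) := by
    rintro ⟨η₀, h₁, h₂⟩
    have h₁' := h₁ 4 four_mem_clarkeSubdiff1_f₁
    have h₂' := h₂ (-3) neg_three_mem_clarkeSubdiff1_f₂
    rw [f₁_of_nonpos (by norm_num), f₁_of_nonpos le_rfl] at h₁'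
    rw [f₂, f₂, abs_zero, abs_of_neg (by norm_num)] at h₂'
    linarith
  exact ⟨fun ⟨η, h⟩ => key ⟨η (-1/3, 0), h (-1/3) 0⟩, key⟩
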